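/- For a prime power q ≥ 2, Σ_{n≥0} 1/|GL(n,q)| = Π_{m≥1} 1/((1-q^(-(5m-4)))(1-q^(-(5m-1)))), where |GL(0,q)| = 1. -/

import Mathlib

open Filter Topology

/-- The reciprocal `1 / (q; q)_n` of the `q`-Pochhammer symbol, extended by zero to `n < 0`. -/
noncomputable def invQPochhammer (q : ℝ) (n : ℤ) : ℝ :=
  if n < 0 then 0 else (∏ i ∈ Finset.range n.toNat, (1 - q ^ (i + 1)))⁻¹

namespace invQPochhammer

variable {q : ℝ}

lemma of_neg {n : ℤ} (hn : n < 0) : invQPochhammer q n = 0 := if_pos hn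

lemma natCast (n : ℕ) :
    invQPochhammer q n = (∏ i ∈ Finset.range n, (1 - q ^ (i + 1)))⁻¹ := by
  simp [invQPochhammer]

@[simp] lemma zero : invQPochhammer q 0 = 1 := by simp [invQPochhammer]

lemma one_sub_pow_pos (h0 : 0 < q) (h1 : q < 1) (i : ℕ) : 0 < 1 - q ^ (i + 1) :=
  sub_pos.2 (pow_lt_one₀ h0.le h1 i.succ_ne_zero)

lemma natCast_pos (h0 : 0 < q) (h1 : q < 1) (n : ℕ) : 0 < invQPochhammer q n := by
  rw [natCast]
  exact inv_pos.2 (Finset.prod_pos fun i _ => one_sub_pow_pos h0 h1 i)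

lemma one_sub_zpow_mul (h0 : 0 < q) (h1 : q < 1) (n : ℤ) :
    (1 - q ^ n) * invQPochhammer q n = invQPochhammer q (n - 1) := by
  rcases lt_trichotomy n 0 with hn | rfl | hn
  · rw [of_neg hn, of_neg (by lia), mul_zero]
  · rw [of_neg (n := 0 - 1) (by lia)]; simp
  · obtain ⟨m, rfl⟩ : ∃ m : ℕ, n = (m + 1 : ℕ) := ⟨(n - 1).toNat, by lia⟩
    have hm : ((m + 1 : ℕ) : ℤ) - 1 = m := by push_cast; ring
    have := (one_sub_pow_pos h0 h1 m).ne'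
    rw [hm, natCast, natCast, Finset.prod_range_succ, mul_inv, zpow_natCast]
    field_simp

lemma nonneg (h0 : 0 < q) (h1 : q < 1) (n : ℤ) : 0 ≤ invQPochhammer q n := by
  rcases lt_or_ge n 0 with hn | hn
  · exact (of_neg hn).ge
  · lift n to ℕ using hn
    exact (natCast_pos h0 h1 n).le

lemma monotone (h0 : 0 < q) (h1 : q < 1) : Monotone (invQPochhammer q) := by
  refine monotone_int_of_le_succ fun n => ?_
  have h := one_sub_zpow_mul h0 h1 (n + 1)
  rw [add_sub_cancel_right] at h
  have := mul_nonneg (zpow_pos h0 (n + 1)).le (nonneg h0 h1 (n + 1))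
  linarith

lemma exists_tendsto (h0 : 0 < q) (h1 : q < 1) :
    ∃ R, 0 < R ∧ Tendsto (invQPochhammer q) atTop (𝓝 R) := by
  have hs : Summable fun i : ℕ => ‖-q ^ (i + 1)‖ := by
    simpa [abs_of_pos h0] using (summable_nat_add_iff 1).2 (summable_geometric_of_lt_one h0.le h1)
  have hne : ∏' i : ℕ, (1 + -q ^ (i + 1)) ≠ 0 :=
    tprod_one_add_ne_zero_of_summable
      (fun i => by simpa [← sub_eq_add_neg] using (one_sub_pow_pos h0 h1 i).ne') hs
  have ht := ((multipliable_one_add_of_summable hs).tendsto_prod_tprod_nat).inv₀ hne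
  have ht' : Tendsto (invQPochhammer q) atTop (𝓝 (∏' i : ℕ, (1 + -q ^ (i + 1)))⁻¹) := by
    rw [← Nat.map_cast_int_atTop, tendsto_map'_iff]
    exact ht.congr fun n => by simp [natCast, sub_eq_add_neg]
  refine ⟨_, ?_, ht'⟩
  have := (monotone h0 h1).ge_of_tendsto ht' 0
  rw [zero] at this
  linarith

/-- The limiting case of the `q`-Chu–Vandermonde summation underlying Bailey's lemma. -/
lemma tsum_mul_mul (h0 : 0 < q) (h1 : q < 1) (n d : ℤ) :
    ∑' k : ℤ, q ^ (k ^ 2 + d * k) *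
      (invQPochhammer q (n - k) * invQPochhammer q k * invQPochhammer q (k + d)) =
      invQPochhammer q n * invQPochhammer q (n + d) := by
  rcases lt_or_ge n 0 with hn | hn
  · rw [of_neg hn, zero_mul]
    refine (tsum_congr fun k => ?_).trans tsum_zero
    rcases lt_or_ge k 0 with hk | hk
    · simp [of_neg hk]
    · simp [of_neg (show n - k < 0 by lia)]
  lift n to ℕ using hn
  induction n generalizing d with
  | zero =>
    rw [tsum_eq_single 0]
    · simp
    · intro k hk
      rcases lt_or_gt_of_ne hk with hk | hk
      · simp [of_neg hk]
      · simp [of_neg (show -k < 0 by lia)]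
  | succ n ih =>
    have hsum (f : ℤ → ℝ) (m : ℤ) : Summable fun k =>
        f k * (invQPochhammer q (m - k) * invQPochhammer q k) := by
      refine summable_of_hasFiniteSupport ((Set.finite_Icc 0 m).subset fun k hk => ?_)
      by_contra h
      rw [Set.mem_Icc, not_and_or, not_le, not_le] at h
      rcases h with h | h
      · simp [of_neg h] at hk
      · simp [of_neg (show m - k < 0 by lia)] at hk
    set r := invQPochhammer q with hr
    have hrec : ∀ k, r (k - 1) = (1 - q ^ k) * r k := fun k => (one_sub_zpow_mul h0 h1 k).symm
    have hq := h0.ne'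
    have hpos : (1 - q ^ ((n : ℤ) + 1)) ≠ 0 := by
      exact_mod_cast (one_sub_pow_pos h0 h1 n).ne'
    apply mul_left_cancel₀ hpos
    have e1 : ∀ k : ℤ, (1 - q ^ ((n : ℤ) + 1)) * (q ^ (k ^ 2 + d * k) *
        (r (((n + 1 : ℕ) : ℤ) - k) * r k * r (k + d))) =
        (q ^ (k ^ 2 + d * k) * r (k + d)) * (r ((n : ℤ) + 1 - k) * r (k - 1)) +
        (q ^ (k ^ 2 + d * k + k) * r (k + d)) * (r (n - k) * r k) := by
      intro k
      have h2 := hrec ((n : ℤ) + 1 - k)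
      rw [show (n : ℤ) + 1 - k - 1 = n - k by ring] at h2
      rw [h2, hrec k, zpow_add₀ hq (k ^ 2 + d * k) k, zpow_sub₀ hq]
      have := (zpow_pos h0 k).ne'
      push_cast
      field_simp
      ring
    have s1 : Summable fun k : ℤ =>
        (q ^ (k ^ 2 + d * k) * r (k + d)) * (r ((n : ℤ) + 1 - k) * r (k - 1)) := by
      rw [← (Equiv.addRight (1 : ℤ)).summable_iff]
      refine (hsum (fun k => q ^ ((k + 1) ^ 2 + d * (k + 1)) * r (k + 1 + d)) n).congr fun k => ?_
      simp
    have s2 := (Equiv.addRight (1 : ℤ)).summable_iff.2 s1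
    simp only [Function.comp_def] at s2
    rw [← tsum_mul_left, tsum_congr e1, s1.tsum_add (hsum _ _),
      ← (Equiv.addRight (1 : ℤ)).tsum_eq, ← s2.tsum_add (hsum _ _)]
    have e2 : (1 - q ^ ((n : ℤ) + 1)) * (r ((n + 1 : ℕ) : ℤ) * r (((n + 1 : ℕ) : ℤ) + d)) =
        r n * r (n + (d + 1)) := by
      have := hrec (n + 1)
      rw [add_sub_cancel_right] at this
      rw [this, show (n : ℤ) + (d + 1) = n + 1 + d by ring]
      push_cast
      ring
    rw [e2, ← ih (d + 1)]
    refine tsum_congr fun k => ?_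
    have h2 := hrec (k + d + 1)
    rw [add_sub_cancel_right] at h2
    simp only [Equiv.coe_addRight]
    rw [add_sub_add_right_eq_sub, add_sub_cancel_right, h2,
      show k + 1 + d = k + d + 1 by ring, show k + (d + 1) = k + d + 1 by ring,
      show (k + 1) ^ 2 + d * (k + 1) = (k ^ 2 + d * k + k) + (k + d + 1) by ring,
      show k ^ 2 + (d + 1) * k = k ^ 2 + d * k + k by ring, zpow_add₀ hq _ (k + d + 1)]
    ring

lemma summable_mul_mul (f : ℤ → ℝ) (a b : ℤ) : Summable fun j =>
    f j * (invQPochhammer q (a - j) * invQPochhammer q (b + j)) := by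
  refine summable_of_hasFiniteSupport ((Set.finite_Icc (-b) a).subset fun j hj => ?_)
  by_contra h
  rw [Set.mem_Icc, not_and_or, not_le, not_le] at h
  rcases h with h | h
  · simp [of_neg (show b + j < 0 by lia)] at hj
  · simp [of_neg (show a - j < 0 by lia)] at hj

/-- A step of **Bailey's lemma** (with `a = 1` and both parameters sent to infinity). -/
lemma bailey (h0 : 0 < q) (h1 : q < 1) (c : ℤ → ℝ) (n : ℤ) :
    ∑' s : ℤ, q ^ s ^ 2 * invQPochhammer q (n - s) *
      ∑' j : ℤ, c j * (invQPochhammer q (s - j) * invQPochhammer q (s + j)) =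
    ∑' j : ℤ, c j * q ^ j ^ 2 * (invQPochhammer q (n - j) * invQPochhammer q (n + j)) := by
  have hs : Summable (Function.uncurry fun s j : ℤ => q ^ s ^ 2 * invQPochhammer q (n - s) *
      (c j * (invQPochhammer q (s - j) * invQPochhammer q (s + j)))) := by
    refine summable_of_hasFiniteSupport
      (((Set.finite_Icc 0 n).prod (Set.finite_Icc (-n) n)).subset fun ⟨s, j⟩ h => ?_)
    simp only [Function.mem_support, Function.uncurry_apply_pair, ne_eq, mul_eq_zero, not_or] at h
    have k1 := not_lt.1 fun k => h.1.2 (of_neg k)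
    have k2 := not_lt.1 fun k => h.2.2.1 (of_neg k)
    have k3 := not_lt.1 fun k => h.2.2.2 (of_neg k)
    simp only [Set.mem_prod, Set.mem_Icc]
    lia
  simp_rw [← tsum_mul_left]
  rw [← hs.tsum_comm]
  refine tsum_congr fun j => ?_
  have key := tsum_mul_mul h0 h1 (n - j) (2 * j)
  rw [show n - j + 2 * j = n + j by ring] at key
  rw [← key, ← tsum_mul_left, ← (Equiv.addRight j).tsum_eq]
  refine tsum_congr fun k => ?_
  simp only [Equiv.coe_addRight]
  rw [add_sub_cancel_right, show n - (k + j) = n - j - k by ring,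
    show k + j + j = k + 2 * j by ring,
    show (k + j) ^ 2 = j ^ 2 + (k ^ 2 + 2 * j * k) by ring, zpow_add₀ h0.ne']
  ring

section theta

variable {c : ℤ → ℝ} {z : ℝ}

lemma one_sub_mul_tsum_left (h0 : 0 < q) (h1 : q < 1) (hc : ∀ j, c (j + 1) = z * q ^ j * c j)
    (a b : ℤ) :
    (1 - q ^ (a + b)) * ∑' j, c j * (invQPochhammer q (a - j) * invQPochhammer q (b + j)) =
      (1 + z * q ^ (a - 1)) *
        ∑' j, c j * (invQPochhammer q (a - 1 - j) * invQPochhammer q (b + j)) := by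
  have hq := h0.ne'
  have e (j : ℤ) : (1 - q ^ (a + b)) *
      (c j * (invQPochhammer q (a - j) * invQPochhammer q (b + j))) =
      c j * (invQPochhammer q (a - 1 - j) * invQPochhammer q (b + j)) +
      q ^ (a - j) * c j * (invQPochhammer q (a - j) * invQPochhammer q (b - 1 + j)) := by
    rw [show a - 1 - j = a - j - 1 by ring, show b - 1 + j = b + j - 1 by ring,
      ← one_sub_zpow_mul h0 h1 (a - j), ← one_sub_zpow_mul h0 h1 (b + j),
      show a + b = (a - j) + (b + j) by ring, zpow_add₀ hq (a - j)]
    ring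
  rw [← tsum_mul_left, tsum_congr e, (summable_mul_mul _ _ _).tsum_add (summable_mul_mul _ _ _),
    ← (Equiv.addRight (1 : ℤ)).tsum_eq
      (fun j => q ^ (a - j) * c j * (invQPochhammer q (a - j) * invQPochhammer q (b - 1 + j))),
    add_mul, one_mul, ← tsum_mul_left]
  congr 1
  refine tsum_congr fun j => ?_
  simp only [Equiv.coe_addRight]
  rw [hc, show a - (j + 1) = a - 1 - j by ring, show b - 1 + (j + 1) = b + j by ring,
    zpow_sub₀ hq (a - 1) j]
  have := (zpow_pos h0 j).ne'
  field_simp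

lemma one_sub_mul_tsum_right (h0 : 0 < q) (h1 : q < 1) (hz : z ≠ 0)
    (hc : ∀ j, c (j + 1) = z * q ^ j * c j) (a b : ℤ) :
    (1 - q ^ (a + b)) * ∑' j, c j * (invQPochhammer q (a - j) * invQPochhammer q (b + j)) =
      (1 + z⁻¹ * q ^ b) *
        ∑' j, c j * (invQPochhammer q (a - j) * invQPochhammer q (b - 1 + j)) := by
  have hq := h0.ne'
  have e (j : ℤ) : (1 - q ^ (a + b)) *
      (c j * (invQPochhammer q (a - j) * invQPochhammer q (b + j))) =
      c j * (invQPochhammer q (a - j) * invQPochhammer q (b - 1 + j)) +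
      q ^ (b + j) * c j * (invQPochhammer q (a - 1 - j) * invQPochhammer q (b + j)) := by
    rw [show a - 1 - j = a - j - 1 by ring, show b - 1 + j = b + j - 1 by ring,
      ← one_sub_zpow_mul h0 h1 (a - j), ← one_sub_zpow_mul h0 h1 (b + j),
      show a + b = (a - j) + (b + j) by ring, zpow_add₀ hq (a - j)]
    ring
  rw [← tsum_mul_left, tsum_congr e, (summable_mul_mul _ _ _).tsum_add (summable_mul_mul _ _ _),
    ← (Equiv.addRight (1 : ℤ)).tsum_eq
      (fun j => c j * (invQPochhammer q (a - j) * invQPochhammer q (b - 1 + j))),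
    add_mul, one_mul, ← tsum_mul_left]
  congr 1
  refine tsum_congr fun j => ?_
  simp only [Equiv.coe_addRight]
  rw [hc, show a - (j + 1) = a - 1 - j by ring, show b - 1 + (j + 1) = b + j by ring,
    zpow_add₀ hq b j]
  field_simp

/-- The finite form of the **Jacobi triple product**, for `c j = z ^ j * q ^ (j * (j - 1) / 2)`. -/
lemma tsum_eq_prod (h0 : 0 < q) (h1 : q < 1) (hz : z ≠ 0)
    (hc : ∀ j, c (j + 1) = z * q ^ j * c j) (hc0 : c 0 = 1) (n : ℕ) :
    ∑' j, c j * (invQPochhammer q (n - j) * invQPochhammer q (n + j)) =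
      invQPochhammer q ((2 * n : ℕ) : ℤ) *
        ∏ i ∈ Finset.range n, (1 + z * q ^ i) * (1 + z⁻¹ * q ^ (i + 1)) := by
  induction n with
  | zero =>
    rw [tsum_eq_single 0]
    · simp [hc0]
    · intro k hk
      rcases lt_or_gt_of_ne hk with hk | hk
      · simp [of_neg hk]
      · simp [of_neg (show -k < 0 by lia)]
  | succ n ih =>
    have hl := one_sub_mul_tsum_left h0 h1 hc ((n : ℤ) + 1) ((n : ℤ) + 1)
    have hr := one_sub_mul_tsum_right h0 h1 hz hc (n : ℤ) ((n : ℤ) + 1)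
    simp only [add_sub_cancel_right] at hl hr
    rw [ih] at hr
    have p1 := one_sub_zpow_mul h0 h1 ((2 * (n + 1) : ℕ) : ℤ)
    have p2 := one_sub_zpow_mul h0 h1 ((2 * n + 1 : ℕ) : ℤ)
    rw [show ((2 * (n + 1) : ℕ) : ℤ) - 1 = ((2 * n + 1 : ℕ) : ℤ) by push_cast; ring] at p1
    rw [show ((2 * n + 1 : ℕ) : ℤ) - 1 = ((2 * n : ℕ) : ℤ) by push_cast; ring] at p2
    have n1 := one_sub_pow_pos h0 h1 (2 * n + 1)
    have n2 := one_sub_pow_pos h0 h1 (2 * n)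
    rw [show (n : ℤ) + 1 + (n + 1) = (2 * (n + 1) : ℕ) by push_cast; ring] at hl
    rw [show (n : ℤ) + (n + 1) = (2 * n + 1 : ℕ) by push_cast; ring] at hr
    rw [zpow_natCast] at hl hr p1 p2
    rw [zpow_natCast] at hl
    rw [← Nat.cast_succ, zpow_natCast, Nat.succ_eq_add_one] at hr
    rw [show 2 * n + 1 + 1 = 2 * (n + 1) by ring] at n1
    rw [← p2, ← p1] at hr
    apply mul_left_cancel₀ n1.ne'
    apply mul_left_cancel₀ n2.ne'
    rw [Finset.prod_range_succ]
    push_cast at hl hr ⊢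
    rw [hl]
    linear_combination (1 + z * q ^ n) * hr

end theta

lemma tendsto_tsum (h0 : 0 < q) (h1 : q < 1) {R : ℝ}
    (hR : Tendsto (invQPochhammer q) atTop (𝓝 R)) {c : ℤ → ℝ} (hc : Summable c) :
    Tendsto (fun n : ℕ => ∑' j, c j * (invQPochhammer q (n - j) * invQPochhammer q (n + j))) atTop
      (𝓝 ((∑' j, c j) * (R * R))) := by
  have hle (n : ℤ) : |invQPochhammer q n| ≤ R := by
    rw [abs_of_nonneg (nonneg h0 h1 n)]
    exact (monotone h0 h1).ge_of_tendsto hR n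
  rw [← tsum_mul_right]
  refine tendsto_tsum_of_dominated_convergence (hc.abs.mul_right (R * R)) (fun j => ?_)
    (Eventually.of_forall fun n j => ?_)
  · have t : Tendsto (fun n : ℕ => (n : ℤ)) atTop atTop := tendsto_natCast_atTop_atTop
    exact ((hR.comp (tendsto_atTop_add_const_right _ (-j) t)).mul
      (hR.comp (tendsto_atTop_add_const_right _ j t))).const_mul _
  · rw [Real.norm_eq_abs, abs_mul, abs_mul]
    gcongr
    · exact (abs_nonneg _).trans (hle 0)
    · exact hle _
    · exact hle _

lemma tendsto_tsum_left (h0 : 0 < q) (h1 : q < 1) {R : ℝ}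
    (hR : Tendsto (invQPochhammer q) atTop (𝓝 R)) {c : ℤ → ℝ} (hc : Summable c) :
    Tendsto (fun n : ℕ => ∑' j, c j * invQPochhammer q (n - j)) atTop (𝓝 ((∑' j, c j) * R)) := by
  have hle (n : ℤ) : |invQPochhammer q n| ≤ R := by
    rw [abs_of_nonneg (nonneg h0 h1 n)]
    exact (monotone h0 h1).ge_of_tendsto hR n
  rw [← tsum_mul_right]
  refine tendsto_tsum_of_dominated_convergence (hc.abs.mul_right R) (fun j => ?_)
    (Eventually.of_forall fun n j => ?_)
  · have t : Tendsto (fun n : ℕ => (n : ℤ)) atTop atTop := tendsto_natCast_atTop_atTop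
    exact (hR.comp (tendsto_atTop_add_const_right _ (-j) t)).const_mul _
  · rw [Real.norm_eq_abs, abs_mul]
    gcongr
    exact hle _

end invQPochhammer

section RogersRamanujan

open invQPochhammer

variable {q : ℝ}

lemma summable_of_abs_le_pow_natAbs (h0 : 0 < q) (h1 : q < 1) {c : ℤ → ℝ} (C : ℝ)
    (hc : ∀ j, |c j| ≤ q ^ j.natAbs * C) : Summable c := by
  refine Summable.of_norm_bounded (Summable.mul_right C ?_) hc
  exact Summable.of_nat_of_neg (by simpa using summable_geometric_of_lt_one h0.le h1)
    (by simpa using summable_geometric_of_lt_one h0.le h1)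

lemma zpow_le_pow_natAbs (h0 : 0 < q) (h1 : q < 1) {m j : ℤ} (h : j ^ 2 ≤ m) :
    q ^ m ≤ q ^ j.natAbs := by
  rw [← zpow_natCast]
  refine zpow_le_zpow_right_of_le_one₀ h0 h1.le (le_trans ?_ h)
  rw [← Int.natAbs_sq]
  exact_mod_cast Nat.le_self_pow two_ne_zero _

/-- The signed theta coefficients `(-1) ^ j * q ^ (j * (j - 1) / 2)`. -/
noncomputable def thetaCoeff (q : ℝ) (j : ℤ) : ℝ := (-1) ^ j * q ^ (j * (j - 1) / 2)

lemma thetaCoeff_zero : thetaCoeff q 0 = 1 := by simp [thetaCoeff]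

lemma thetaCoeff_add_one (h0 : 0 < q) (j : ℤ) :
    thetaCoeff q (j + 1) = -1 * q ^ j * thetaCoeff q j := by
  have h : (j + 1) * (j + 1 - 1) / 2 = j * (j - 1) / 2 + j := by
    rw [show (j + 1) * (j + 1 - 1) = j * (j - 1) + j * 2 by ring,
      Int.add_mul_ediv_right _ _ two_ne_zero]
  rw [thetaCoeff, thetaCoeff, h, zpow_add₀ h0.ne', zpow_add_one₀ (by norm_num)]
  ring

lemma abs_thetaCoeff_le_one (h0 : 0 < q) (h1 : q < 1) (j : ℤ) : |thetaCoeff q j| ≤ 1 := by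
  rw [thetaCoeff, abs_mul, abs_zpow, abs_neg, abs_one, one_zpow, one_mul,
    abs_of_pos (zpow_pos h0 _)]
  refine (zpow_le_zpow_right_of_le_one₀ h0 h1.le (Int.ediv_nonneg ?_ zero_le_two)).trans_eq
    (zpow_zero q)
  rcases lt_or_ge j 1 with h | h
  · exact mul_nonneg_of_nonpos_of_nonpos (by lia) (by lia)
  · exact mul_nonneg (by lia) (by lia)

/-- The orthogonality relation defining the unit Bailey pair. -/
lemma tsum_thetaCoeff (h0 : 0 < q) (h1 : q < 1) (s : ℤ) :
    ∑' j, thetaCoeff q j * (invQPochhammer q (s - j) * invQPochhammer q (s + j)) =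
      if s = 0 then 1 else 0 := by
  rcases lt_or_ge s 0 with hs | hs
  · rw [if_neg hs.ne]
    refine (tsum_congr fun j => ?_).trans tsum_zero
    rcases lt_or_ge j 0 with hj | hj
    · simp [of_neg (show s + j < 0 by lia)]
    · simp [of_neg (show s - j < 0 by lia)]
  · lift s to ℕ using hs
    rw [tsum_eq_prod h0 h1 (by norm_num) (thetaCoeff_add_one h0) thetaCoeff_zero]
    cases s with
    | zero => simp
    | succ n => simp [Finset.prod_range_succ', Nat.cast_add_one_ne_zero]

/-- The finite form of the first **Rogers–Ramanujan identity**, before the triple product. -/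
lemma tsum_zpow_sq_mul (h0 : 0 < q) (h1 : q < 1) (n : ℤ) :
    ∑' s : ℤ, q ^ s ^ 2 * invQPochhammer q s * invQPochhammer q (n - s) =
      ∑' j : ℤ, thetaCoeff q j * q ^ j ^ 2 * q ^ j ^ 2 *
        (invQPochhammer q (n - j) * invQPochhammer q (n + j)) := by
  rw [← bailey h0 h1 (fun j => thetaCoeff q j * q ^ j ^ 2)]
  refine tsum_congr fun s => ?_
  rw [← bailey h0 h1, tsum_eq_single 0]
  · rw [tsum_thetaCoeff h0 h1]
    simp
    ring
  · intro t ht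
    rw [tsum_thetaCoeff h0 h1, if_neg ht, mul_zero]

lemma prod_range_five_mul {M : Type*} [CommMonoid M] (f : ℕ → M) (n : ℕ) :
    ∏ i ∈ Finset.range (5 * n), f i = ∏ i ∈ Finset.range n,
      f (5 * i) * f (5 * i + 1) * f (5 * i + 2) * f (5 * i + 3) * f (5 * i + 4) := by
  induction n with
  | zero => simp
  | succ n ih =>
    rw [Finset.prod_range_succ, ← ih, show 5 * (n + 1) = 5 * n + 1 + 1 + 1 + 1 + 1 by ring]
    simp only [Finset.prod_range_succ, mul_assoc]

/-- The first **Rogers–Ramanujan identity**. -/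
theorem tendsto_prod_rogersRamanujan (h0 : 0 < q) (h1 : q < 1) :
    Tendsto (fun n => ∏ i ∈ Finset.range n, ((1 - q ^ (5 * i + 1)) * (1 - q ^ (5 * i + 4)))⁻¹)
      atTop (𝓝 (∑' n : ℕ, q ^ n ^ 2 * (∏ i ∈ Finset.range n, (1 - q ^ (i + 1)))⁻¹)) := by
  obtain ⟨R, hRpos, hR⟩ := exists_tendsto h0 h1
  have p0 : 0 < q ^ 5 := pow_pos h0 5
  have p1 : q ^ 5 < 1 := pow_lt_one₀ h0.le h1 (by norm_num)
  obtain ⟨R', hRpos', hR'⟩ := exists_tendsto p0 p1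
  set c : ℤ → ℝ := fun j => thetaCoeff q j * q ^ j ^ 2 * q ^ j ^ 2 with hc
  have hcs : Summable c := by
    refine summable_of_abs_le_pow_natAbs h0 h1 1 fun j => ?_
    simp only [hc]
    rw [mul_one, mul_assoc, ← zpow_add₀ h0.ne', abs_mul, abs_of_pos (zpow_pos h0 _)]
    refine (mul_le_of_le_one_left (zpow_pos h0 _).le (abs_thetaCoeff_le_one h0 h1 j)).trans
      (zpow_le_pow_natAbs h0 h1 ?_)
    nlinarith [sq_nonneg j]
  have hle (s : ℤ) : invQPochhammer q s ≤ R := (monotone h0 h1).ge_of_tendsto hR s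
  have has : Summable fun s : ℤ => q ^ s ^ 2 * invQPochhammer q s := by
    refine summable_of_abs_le_pow_natAbs h0 h1 R fun s => ?_
    have hp := zpow_pos h0 (s ^ 2)
    rw [abs_of_nonneg (mul_nonneg hp.le (nonneg h0 h1 s))]
    exact mul_le_mul (zpow_le_pow_natAbs h0 h1 le_rfl) (hle s) (nonneg h0 h1 s) (by positivity)
  have hA : ∑' n : ℕ, q ^ n ^ 2 * (∏ i ∈ Finset.range n, (1 - q ^ (i + 1)))⁻¹ =
      ∑' s : ℤ, q ^ s ^ 2 * invQPochhammer q s := by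
    rw [← (Nat.cast_injective (R := ℤ)).tsum_eq]
    · refine tsum_congr fun n => ?_
      rw [natCast]
      norm_cast
    · intro s hs
      refine ⟨s.toNat, Int.toNat_of_nonneg (not_lt.1 fun h => hs ?_)⟩
      simp [of_neg h]
  have hlim : (∑' s : ℤ, q ^ s ^ 2 * invQPochhammer q s) * R = (∑' j, c j) * (R * R) := by
    refine tendsto_nhds_unique (tendsto_tsum_left h0 h1 hR has) ?_
    refine (tendsto_tsum h0 h1 hR hcs).congr fun n => ?_
    exact (tsum_zpow_sq_mul h0 h1 n).symm
  have hval : (∑' s : ℤ, q ^ s ^ 2 * invQPochhammer q s) = (∑' j, c j) * R :=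
    mul_right_cancel₀ hRpos.ne' (by rw [hlim]; ring)
  rw [hA, hval]
  have hrec (j : ℤ) : c (j + 1) = -q ^ 2 * (q ^ 5) ^ j * c j := by
    have e1 : (q : ℝ) ^ (j + 1) ^ 2 = q ^ j ^ 2 * (q ^ j * q ^ j * q) := by
      rw [← zpow_add₀ h0.ne', ← zpow_add_one₀ h0.ne', ← zpow_add₀ h0.ne']
      ring_nf
    have e2 : ((q : ℝ) ^ 5) ^ j = (q ^ j) ^ 5 := by
      rw [← zpow_natCast, ← zpow_natCast, ← zpow_mul, ← zpow_mul, mul_comm]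
    simp only [hc]
    rw [thetaCoeff_add_one h0, e1, e2]
    ring
  have hzero : c 0 = 1 := by simp [hc, thetaCoeff_zero]
  have hjac := tsum_eq_prod p0 p1 (neg_ne_zero.2 (pow_pos h0 2).ne') hrec hzero
  have t2 (k : ℕ) (hk : 0 < k) : Tendsto (fun n : ℕ => ((k * n : ℕ) : ℤ)) atTop atTop :=
    tendsto_natCast_atTop_atTop.comp (tendsto_id.const_mul_atTop' hk)
  have lim1 := (tendsto_tsum p0 p1 hR' hcs).div (hR'.comp (t2 2 two_pos)) hRpos'.ne'
  have lim2 := (lim1.div (hR'.comp (t2 1 one_pos)) hRpos'.ne').mul (hR.comp (t2 5 (by norm_num)))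
  have hv : (∑' j, c j) * (R' * R') / R' / R' * R = (∑' j, c j) * R := by
    field_simp
  rw [hv] at lim2
  refine lim2.congr fun n => ?_
  simp only [Pi.div_apply, Function.comp_apply]
  rw [hjac, mul_div_cancel_left₀ _ (natCast_pos p0 p1 _).ne', natCast, natCast, one_mul,
    div_inv_eq_mul, prod_range_five_mul, ← Finset.prod_inv_distrib, ← Finset.prod_mul_distrib,
    ← Finset.prod_mul_distrib]
  refine Finset.prod_congr rfl fun i _ => ?_
  have f1 := (one_sub_pow_pos h0 h1 (5 * i)).ne'
  have f2 := (one_sub_pow_pos h0 h1 (5 * i + 1)).ne'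
  have f3 := (one_sub_pow_pos h0 h1 (5 * i + 2)).ne'
  have f4 := (one_sub_pow_pos h0 h1 (5 * i + 3)).ne'
  have f5 := (one_sub_pow_pos h0 h1 (5 * i + 4)).ne'
  have g2 : 1 + -q ^ 2 * (q ^ 5) ^ i = 1 - q ^ (5 * i + 1 + 1) := by
    rw [← pow_mul]; ring
  have g3 : 1 + (-q ^ 2)⁻¹ * (q ^ 5) ^ (i + 1) = 1 - q ^ (5 * i + 2 + 1) := by
    rw [← pow_mul, show 5 * (i + 1) = 2 + (5 * i + 2 + 1) by ring, pow_add]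
    field_simp
    ring
  have g5 : 1 - (q ^ 5) ^ (i + 1) = 1 - q ^ (5 * i + 4 + 1) := by
    rw [← pow_mul]; ring
  rw [g2, g3, g5]
  field_simp

lemma multipliable_rogersRamanujan (h0 : 0 < q) (h1 : q < 1) :
    Multipliable fun i : ℕ => ((1 - q ^ (5 * i + 1)) * (1 - q ^ (5 * i + 4)))⁻¹ := by
  have key (k : ℕ) : Multipliable fun i : ℕ => (1 - q ^ (5 * i + k + 1))⁻¹ := by
    have hs : Summable fun i : ℕ => q ^ (5 * i + k + 1) * (1 - q)⁻¹ := by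
      refine ((summable_geometric_of_lt_one h0.le h1).of_nonneg_of_le (fun i => by positivity)
        fun i => ?_).mul_right _
      exact pow_le_pow_of_le_one h0.le h1.le (by lia)
    refine (Real.multipliable_one_add_of_summable (hs.of_nonneg_of_le (fun i =>
      mul_nonneg (pow_nonneg h0.le (5 * i + k + 1))
        (inv_nonneg.2 (one_sub_pow_pos h0 h1 (5 * i + k)).le)) fun i => ?_)).congr fun i => ?_
    · have := sub_pos.2 h1
      gcongr
      exact pow_le_of_le_one h0.le h1.le (by lia)
    · have := (one_sub_pow_pos h0 h1 (5 * i + k)).ne'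
      field_simp
      ring
  refine ((key 0).mul (key 3)).congr fun i => ?_
  rw [mul_inv]

end RogersRamanujan

lemma one_div_card_GL (Fq : Type*) [Field Fq] [Fintype Fq] (n : ℕ) :
    (1 : ℝ) / Nat.card (Matrix.GeneralLinearGroup (Fin n) Fq) =
      ((Fintype.card Fq : ℝ)⁻¹) ^ n ^ 2 *
        (∏ i ∈ Finset.range n, (1 - ((Fintype.card Fq : ℝ)⁻¹) ^ (i + 1)))⁻¹ := by
  have hq : 0 < Fintype.card Fq := Fintype.card_pos
  have hq' : (Fintype.card Fq : ℝ) ≠ 0 := by positivity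
  have key : (Nat.card (Matrix.GeneralLinearGroup (Fin n) Fq) : ℝ) =
      (Fintype.card Fq : ℝ) ^ n ^ 2 *
        ∏ i ∈ Finset.range n, (1 - ((Fintype.card Fq : ℝ)⁻¹) ^ (i + 1)) := by
    rw [Matrix.card_GL_field, Fin.prod_univ_eq_prod_range
      (fun i => Fintype.card Fq ^ n - Fintype.card Fq ^ i), Nat.cast_prod,
      ← Finset.prod_range_reflect (fun i => 1 - ((Fintype.card Fq : ℝ)⁻¹) ^ (i + 1)), sq, pow_mul,
      show ((Fintype.card Fq : ℝ) ^ n) ^ n = ∏ _i ∈ Finset.range n, (Fintype.card Fq : ℝ) ^ n by simp,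
      ← Finset.prod_mul_distrib]
    refine Finset.prod_congr rfl fun i hi => ?_
    have hi := Finset.mem_range.1 hi
    rw [Nat.cast_sub (Nat.pow_le_pow_right hq hi.le), show n - 1 - i + 1 = n - i by lia, mul_sub,
      mul_one, inv_pow, ← pow_sub₀ _ hq' (Nat.sub_le n i), Nat.sub_sub_self hi.le, Nat.cast_pow,
      Nat.cast_pow]
  rw [key, one_div, mul_inv, inv_pow]

/-- For a prime power `q` (the cardinality of a finite field `Fq`),
`∑_{n≥0} 1/|GL(n,q)| = ∏_{m≥1} 1/((1-q^{-(5m-4)})(1-q^{-(5m-1)}))`,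
where `|GL(0,q)| = 1`. -/
theorem sum_inv_card_GL (Fq : Type) [Field Fq] [Fintype Fq] [DecidableEq Fq]
    (q : ℕ) (hq : q = Fintype.card Fq) :
    ∑' n : ℕ, (1 : ℝ) / Nat.card (Matrix.GeneralLinearGroup (Fin n) Fq) =
      ∏' m : ℕ, 1 / ((1 - (q : ℝ) ^ (-(5 * ((m : ℤ) + 1) - 4))) *
        (1 - (q : ℝ) ^ (-(5 * ((m : ℤ) + 1) - 1)))) := by
  have hq1 : 1 < (q : ℝ) := by
    rw [hq]
    exact_mod_cast Fintype.one_lt_card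
  have h0 : 0 < (q : ℝ)⁻¹ := by positivity
  have h1 : (q : ℝ)⁻¹ < 1 := inv_lt_one_of_one_lt₀ hq1
  have hfactor (m : ℕ) : 1 / ((1 - (q : ℝ) ^ (-(5 * ((m : ℤ) + 1) - 4))) *
      (1 - (q : ℝ) ^ (-(5 * ((m : ℤ) + 1) - 1)))) =
      ((1 - (q : ℝ)⁻¹ ^ (5 * m + 1)) * (1 - (q : ℝ)⁻¹ ^ (5 * m + 4)))⁻¹ := by
    rw [one_div, show 5 * ((m : ℤ) + 1) - 4 = (5 * m + 1 : ℕ) by push_cast; ring,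
      show 5 * ((m : ℤ) + 1) - 1 = (5 * m + 4 : ℕ) by push_cast; ring]
    simp only [zpow_neg, zpow_natCast, inv_pow]
  simp_rw [hfactor, one_div_card_GL, ← hq]
  exact tendsto_nhds_unique (tendsto_prod_rogersRamanujan h0 h1)
    (multipliable_rogersRamanujan h0 h1).tendsto_prod_tprod_nat
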